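/- Let X be a rearrangement invariant space over (-1,1) with nontrivial Boyd indices. Then the finite Hilbert transform T_X : X → X is neither completely continuous nor order bounded; in particular T_X is not compact. -/

import Mathlib

open MeasureTheory Set Filter Topology ENNReal NNReal

noncomputable section

/-- Lebesgue measure on the interval `(-1, 1)`. -/
def vol : Measure ℝ := volume.restrict (Set.Ioo (-1 : ℝ) 1)

/-- The finite Hilbert transform, defined at `x` as the principal value
`(1/π) lim_{ε→0⁺} (∫_{-1}^{x-ε} + ∫_{x+ε}^{1}) f(y)/(y-x) dy`. -/
def FHT (f : ℝ → ℝ) (x : ℝ) : ℝ :=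
  limUnder (nhdsWithin (0 : ℝ) (Set.Ioi 0)) fun ε : ℝ =>
    (1 / Real.pi) * ((∫ y in Set.Ioo (-1 : ℝ) (x - ε), f y / (y - x)) +
      ∫ y in Set.Ioo (x + ε) (1 : ℝ), f y / (y - x))

/-- Order continuity of the norm: `f_n ↓ 0` (a.e.) implies `‖f_n‖ ↓ 0`. -/
def OrderContinuousNorm (Mem : (ℝ → ℝ) → Prop) (Nrm : (ℝ → ℝ) → ℝ) : Prop :=
  ∀ f : ℕ → ℝ → ℝ, (∀ n, Mem (f n)) →
    (∀ n, ∀ᵐ x ∂vol, 0 ≤ f (n + 1) x ∧ f (n + 1) x ≤ f n x) →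
    (∀ᵐ x ∂vol, Tendsto (fun n => f n x) atTop (𝓝 0)) →
    Tendsto (fun n => Nrm (f n)) atTop (𝓝 0)

/-- The Fatou property: for a norm-bounded increasing sequence `0 ≤ f_n ↑ g` one has
`g ∈ X` and `‖f_n‖ → ‖g‖`. -/
def FatouProperty (Mem : (ℝ → ℝ) → Prop) (Nrm : (ℝ → ℝ) → ℝ) : Prop :=
  ∀ (f : ℕ → ℝ → ℝ) (g : ℝ → ℝ) (C : ℝ), (∀ n, Mem (f n)) → AEMeasurable g vol →
    (∀ n, ∀ᵐ x ∂vol, 0 ≤ f n x ∧ f n x ≤ f (n + 1) x) →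
    (∀ᵐ x ∂vol, Tendsto (fun n => f n x) atTop (𝓝 (g x))) →
    (∀ n, Nrm (f n) ≤ C) →
    Mem g ∧ Tendsto (fun n => Nrm (f n)) atTop (𝓝 (Nrm g))

/-- The order continuous (absolutely continuous) part `Y_a` of a function space:
`f ∈ Y_a` iff `|f| ≥ g_n ↓ 0` (a.e.) implies `‖g_n‖ ↓ 0`. -/
def OCPart (Mem : (ℝ → ℝ) → Prop) (Nrm : (ℝ → ℝ) → ℝ) (f : ℝ → ℝ) : Prop :=
  Mem f ∧ ∀ g : ℕ → ℝ → ℝ, (∀ n, Mem (g n)) →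
    (∀ n, ∀ᵐ x ∂vol, 0 ≤ g n x ∧ g (n + 1) x ≤ g n x ∧ g n x ≤ |f x|) →
    (∀ᵐ x ∂vol, Tendsto (fun n => g n x) atTop (𝓝 0)) →
    Tendsto (fun n => Nrm (g n)) atTop (𝓝 0)

/-- A Banach function space over `((-1,1), ℬ, μ)`: an order ideal of `L⁰` containing the
simple functions, complete under a lattice norm. -/
structure BFS where
  Mem : (ℝ → ℝ) → Prop
  Nrm : (ℝ → ℝ) → ℝ
  mem_aemeasurable : ∀ f, Mem f → AEMeasurable f vol
  mem_congr : ∀ f g, f =ᵐ[vol] g → Mem f → Mem g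
  nrm_congr : ∀ f g, f =ᵐ[vol] g → Nrm f = Nrm g
  add_mem : ∀ f g, Mem f → Mem g → Mem (f + g)
  smul_mem : ∀ (c : ℝ) f, Mem f → Mem (c • f)
  ideal_mem : ∀ f g, Mem f → AEMeasurable g vol → (∀ᵐ x ∂vol, |g x| ≤ |f x|) → Mem g
  simple_mem : ∀ s : MeasureTheory.SimpleFunc ℝ ℝ, Mem s
  nrm_nonneg : ∀ f, Mem f → 0 ≤ Nrm f
  nrm_eq_zero_iff : ∀ f, Mem f → (Nrm f = 0 ↔ f =ᵐ[vol] 0)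
  nrm_add_le : ∀ f g, Mem f → Mem g → Nrm (f + g) ≤ Nrm f + Nrm g
  nrm_smul : ∀ (c : ℝ) f, Mem f → Nrm (c • f) = |c| * Nrm f
  nrm_mono : ∀ f g, Mem f → Mem g → (∀ᵐ x ∂vol, |f x| ≤ |g x|) → Nrm f ≤ Nrm g
  complete : ∀ f : ℕ → ℝ → ℝ, (∀ n, Mem (f n)) →
    (∀ ε : ℝ, 0 < ε → ∃ N, ∀ m ≥ N, ∀ n ≥ N, Nrm (f m - f n) < ε) →
    ∃ g, Mem g ∧ Tendsto (fun n => Nrm (f n - g)) atTop (𝓝 0)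

/-- Distribution function `λ ↦ μ{|f| > λ}`. -/
def distrib (f : ℝ → ℝ) (lam : ℝ) : ℝ≥0∞ := vol {x | lam < |f x|}

/-- Rearrangement invariant space: Fatou property, membership is monotone with respect to
the distribution function (equivalently the decreasing rearrangement), and the norm is
rearrangement invariant. -/
def RearrInvariant (X : BFS) : Prop :=
  FatouProperty X.Mem X.Nrm ∧
  (∀ f g, X.Mem f → AEMeasurable g vol →
    (∀ lam : ℝ, 0 < lam → distrib g lam ≤ distrib f lam) → X.Mem g) ∧
  (∀ f g, X.Mem f → X.Mem g →
    (∀ lam : ℝ, 0 < lam → distrib g lam = distrib f lam) → X.Nrm g = X.Nrm f)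

/-- The dilation operator `E_t`. -/
def dilate (t : ℝ) (f : ℝ → ℝ) : ℝ → ℝ := fun x =>
  if t * x ∈ Set.Ioo (-1 : ℝ) 1 then f (t * x) else 0

/-- The operator norm of the dilation `E_t` on `X`. -/
def dilNorm (X : BFS) (t : ℝ) : ℝ :=
  sInf {C : ℝ | 0 ≤ C ∧ ∀ f, X.Mem f → X.Mem (dilate t f) ∧ X.Nrm (dilate t f) ≤ C * X.Nrm f}

/-- The lower Boyd index of `X`. -/
def lowerBoyd (X : BFS) : ℝ :=
  sSup {r : ℝ | ∃ t ∈ Set.Ioo (0 : ℝ) 1, r = Real.log (dilNorm X (1 / t)) / Real.log t}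

/-- The upper Boyd index of `X`. -/
def upperBoyd (X : BFS) : ℝ :=
  sInf {r : ℝ | ∃ t ∈ Set.Ioi (1 : ℝ), r = Real.log (dilNorm X (1 / t)) / Real.log t}

/-- Nontrivial Boyd indices: `0 < α_X ≤ ᾱ_X < 1`. -/
def NontrivialBoyd (X : BFS) : Prop :=
  0 < lowerBoyd X ∧ lowerBoyd X ≤ upperBoyd X ∧ upperBoyd X < 1

/-- The finite Hilbert transform maps `X` boundedly into `X` (Boyd's theorem). -/
def THilbBounded (X : BFS) : Prop :=
  (∀ f, X.Mem f → X.Mem (FHT f)) ∧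
  ∃ C : ℝ, ∀ f, X.Mem f → X.Nrm (FHT f) ≤ C * X.Nrm f

/-- A bounded linear functional on the Banach function space `X`. -/
def Functional (X : BFS) (φ : (ℝ → ℝ) → ℝ) : Prop :=
  (∀ f g, X.Mem f → X.Mem g → φ (f + g) = φ f + φ g) ∧
  (∀ (c : ℝ) f, X.Mem f → φ (c • f) = c * φ f) ∧
  (∀ f g, X.Mem f → X.Mem g → f =ᵐ[vol] g → φ f = φ g) ∧
  ∃ C : ℝ, ∀ f, X.Mem f → |φ f| ≤ C * X.Nrm f

/-- Relative weak compactness of a subset of `X` (via Eberlein–Šmulian: every sequence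
has a weakly convergent subsequence). -/
def RelWeaklyCompact (X : BFS) (S : Set (ℝ → ℝ)) : Prop :=
  ∀ f : ℕ → ℝ → ℝ, (∀ n, f n ∈ S) → ∃ φ : ℕ → ℕ, StrictMono φ ∧ ∃ g, X.Mem g ∧
    ∀ ψ, Functional X ψ → Tendsto (fun n => ψ (f (φ n))) atTop (𝓝 (ψ g))

/-- Relative norm compactness of a subset of `X` (every sequence has a norm convergent
subsequence). -/
def RelNormCompact (X : BFS) (S : Set (ℝ → ℝ)) : Prop :=
  ∀ f : ℕ → ℝ → ℝ, (∀ n, f n ∈ S) → ∃ φ : ℕ → ℕ, StrictMono φ ∧ ∃ g, X.Mem g ∧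
    Tendsto (fun n => X.Nrm (f (φ n) - g)) atTop (𝓝 0)

/-- Order boundedness of a subset of `X`. -/
def OrderBddSet (X : BFS) (S : Set (ℝ → ℝ)) : Prop :=
  ∃ h, X.Mem h ∧ ∀ f ∈ S, ∀ᵐ x ∂vol, |f x| ≤ h x

/-- A completely continuous operator maps relatively weakly compact sets to relatively
norm compact sets. -/
def CompletelyContinuousOp (X : BFS) (T : (ℝ → ℝ) → ℝ → ℝ) : Prop :=
  ∀ S : Set (ℝ → ℝ), (∀ f ∈ S, X.Mem f) → RelWeaklyCompact X S → RelNormCompact X (T '' S)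

/-- An order bounded operator maps order bounded sets to order bounded sets. -/
def OrderBoundedOp (X : BFS) (T : (ℝ → ℝ) → ℝ → ℝ) : Prop :=
  ∀ S : Set (ℝ → ℝ), (∀ f ∈ S, X.Mem f) → OrderBddSet X S → OrderBddSet X (T '' S)

/-- A compact operator maps the unit ball to a relatively norm compact set. -/
def CompactOp (X : BFS) (T : (ℝ → ℝ) → ℝ → ℝ) : Prop :=
  RelNormCompact X (T '' {f | X.Mem f ∧ X.Nrm f ≤ 1})

/-- `sin (n arccos y)`. -/
def fs (n : ℕ) (y : ℝ) : ℝ := Real.sin (n * Real.arccos y)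

/-- `cos (n arccos y)`. -/
def fc (n : ℕ) (y : ℝ) : ℝ := Real.cos (n * Real.arccos y)

lemma fs_cont (n : ℕ) : Continuous (fs n) := by
  unfold fs
  exact Real.continuous_sin.comp (continuous_const.mul Real.continuous_arccos)

lemma fc_cont (n : ℕ) : Continuous (fc n) := by
  unfold fc
  exact Real.continuous_cos.comp (continuous_const.mul Real.continuous_arccos)

lemma fs_le (n : ℕ) (y : ℝ) : |fs n y| ≤ 1 := Real.abs_sin_le_one _

lemma fc_le (n : ℕ) (y : ℝ) : |fc n y| ≤ 1 := Real.abs_cos_le_one _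

lemma fs_one (y : ℝ) : fs 1 y = √(1 - y ^ 2) := by
  simp [fs, Real.sin_arccos]

lemma fs_rec (n : ℕ) (y : ℝ) (h1 : -1 ≤ y) (h2 : y ≤ 1) :
    fs (n + 2) y = 2 * (y * fs (n + 1) y) - fs n y := by
  have h : y = Real.cos (Real.arccos y) := (Real.cos_arccos h1 h2).symm
  unfold fs
  generalize Real.arccos y = t at *
  subst h
  push_cast
  rw [show ((n : ℝ) + 2) * t = (n + 1) * t + t by ring,
    show (n : ℝ) * t = (n + 1) * t - t by ring, Real.sin_add, Real.sin_sub]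
  ring

lemma fc_rec (n : ℕ) (y : ℝ) (h1 : -1 ≤ y) (h2 : y ≤ 1) :
    fc (n + 2) y = 2 * (y * fc (n + 1) y) - fc n y := by
  have h : y = Real.cos (Real.arccos y) := (Real.cos_arccos h1 h2).symm
  unfold fc
  generalize Real.arccos y = t at *
  subst h
  push_cast
  rw [show ((n : ℝ) + 2) * t = (n + 1) * t + t by ring,
    show (n : ℝ) * t = (n + 1) * t - t by ring, Real.cos_add, Real.cos_sub]
  ring

open Polynomial.Chebyshev in
lemma int_cos_ne (k : ℤ) (hk : k ≠ 0) :
    ∫ x, Real.cos (k * Real.arccos x) ∂measureT = 0 := by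
  rw [← integral_eval_T_real_measureT_of_ne_zero hk, integral_measureT_eq_integral_cos,
    integral_measureT_eq_integral_cos]
  apply intervalIntegral.integral_congr
  intro t ht
  rw [uIcc_of_le Real.pi_pos.le] at ht
  simp only
  rw [Real.arccos_cos ht.1 ht.2, Polynomial.Chebyshev.T_real_cos]

open Polynomial.Chebyshev in
lemma int_cos (k : ℤ) :
    ∫ x, Real.cos (k * Real.arccos x) ∂measureT = if k = 0 then Real.pi else 0 := by
  split_ifs with h
  · subst h
    rw [integral_measureT_eq_integral_cos]
    simp
  · exact int_cos_ne k h

open Polynomial.Chebyshev in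
lemma integrable_cos_arccos (k : ℤ) :
    Integrable (fun x => Real.cos (k * Real.arccos x)) measureT :=
  integrable_measureT (by
    exact (Real.continuous_cos.comp (continuous_const.mul Real.continuous_arccos)).continuousOn)

open Polynomial.Chebyshev in
lemma int_fs_fs (n m : ℕ) (hn : n ≠ 0) :
    ∫ x, fs n x * fs m x ∂measureT = if n = m then Real.pi / 2 else 0 := by
  have : ∀ x, fs n x * fs m x = (1 / 2) * (Real.cos (((n - m : ℤ) : ℝ) * Real.arccos x)
      - Real.cos (((n + m : ℤ) : ℝ) * Real.arccos x)) := by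
    intro x
    unfold fs
    push_cast
    rw [sub_mul, add_mul, Real.cos_sub, Real.cos_add]
    ring
  simp_rw [this]
  rw [integral_const_mul, integral_sub (integrable_cos_arccos _) (integrable_cos_arccos _),
    int_cos, int_cos, if_neg (show ¬ ((n : ℤ) + m = 0) by omega)]
  by_cases h : n = m
  · rw [if_pos (by omega), if_pos h]; ring
  · rw [if_neg (by omega), if_neg h]; ring

open Polynomial.Chebyshev in
lemma int_fc_fc (n m : ℕ) (hn : n ≠ 0) :
    ∫ x, fc n x * fc m x ∂measureT = if n = m then Real.pi / 2 else 0 := by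
  have : ∀ x, fc n x * fc m x = (1 / 2) * (Real.cos (((n - m : ℤ) : ℝ) * Real.arccos x)
      + Real.cos (((n + m : ℤ) : ℝ) * Real.arccos x)) := by
    intro x
    unfold fc
    push_cast
    rw [sub_mul, add_mul, Real.cos_sub, Real.cos_add]
    ring
  simp_rw [this]
  rw [integral_const_mul, integral_add (integrable_cos_arccos _) (integrable_cos_arccos _),
    int_cos, int_cos, if_neg (show ¬ ((n : ℤ) + m = 0) by omega)]
  by_cases h : n = m
  · rw [if_pos (by omega), if_pos h]; ring
  · rw [if_neg (by omega), if_neg h]; ring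

open Polynomial.Chebyshev in
lemma int_fs (n : ℕ) (hn : n ≠ 0) :
    ∫ y in (-1 : ℝ)..1, fs n y = if n = 1 then Real.pi / 2 else 0 := by
  rw [← int_fs_fs n 1 hn, integral_measureT]
  rw [intervalIntegral.integral_of_le (by norm_num), intervalIntegral.integral_of_le (by norm_num),
    integral_Ioc_eq_integral_Ioo, integral_Ioc_eq_integral_Ioo]
  apply setIntegral_congr_fun measurableSet_Ioo
  intro y hy
  have h : 0 < 1 - y ^ 2 := by nlinarith [hy.1, hy.2]
  have h2 : √(1 - y ^ 2) ≠ 0 := (Real.sqrt_pos.2 h).ne'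
  simp only [fs_one, Real.sqrt_inv]
  field_simp

/-- Truncated principal value integral. -/
def pvI (f : ℝ → ℝ) (x ε : ℝ) : ℝ :=
  (∫ y in Set.Ioo (-1 : ℝ) (x - ε), f y / (y - x)) +
      ∫ y in Set.Ioo (x + ε) (1 : ℝ), f y / (y - x)

lemma pvI_eq (f : ℝ → ℝ) (x ε : ℝ) (h1 : -1 ≤ x - ε) (h2 : x + ε ≤ 1) :
    pvI f x ε = (∫ y in (-1 : ℝ)..(x - ε), f y / (y - x)) +
      ∫ y in (x + ε)..(1 : ℝ), f y / (y - x) := by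
  rw [pvI, intervalIntegral.integral_of_le h1, intervalIntegral.integral_of_le h2,
    integral_Ioc_eq_integral_Ioo, integral_Ioc_eq_integral_Ioo]

lemma ev_range (x : ℝ) (hx : x ∈ Ioo (-1 : ℝ) 1) :
    ∀ᶠ ε in 𝓝[>] (0 : ℝ), 0 < ε ∧ -1 < x - ε ∧ x + ε < 1 := by
  have h : ∀ᶠ ε in 𝓝[>] (0 : ℝ), ε ∈ Ioo (0 : ℝ) (min (x + 1) (1 - x)) :=
    Ioo_mem_nhdsGT (lt_min (by linarith [hx.1]) (by linarith [hx.2]))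
  filter_upwards [h] with ε hε
  have h1 := hε.2.trans_le (min_le_left _ _)
  have h2 := hε.2.trans_le (min_le_right _ _)
  exact ⟨hε.1, by linarith, by linarith⟩

lemma cont_left (f : ℝ → ℝ) (hf : Continuous f) (x ε : ℝ) (h0 : 0 < ε) (h1 : -1 ≤ x - ε) :
    IntervalIntegrable (fun y => f y / (y - x)) volume (-1) (x - ε) := by
  apply ContinuousOn.intervalIntegrable
  rw [uIcc_of_le h1]
  refine hf.continuousOn.div (by fun_prop) ?_
  intro y hy
  have h : y - x < 0 := by linarith [hy.2]
  exact h.ne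

lemma cont_right (f : ℝ → ℝ) (hf : Continuous f) (x ε : ℝ) (h0 : 0 < ε) (h1 : x + ε ≤ 1) :
    IntervalIntegrable (fun y => f y / (y - x)) volume (x + ε) 1 := by
  apply ContinuousOn.intervalIntegrable
  rw [uIcc_of_le h1]
  refine hf.continuousOn.div (by fun_prop) ?_
  intro y hy
  have h : 0 < y - x := by linarith [hy.1]
  exact h.ne'

lemma pv_step (f g k : ℝ → ℝ) (hf : Continuous f) (hg : Continuous g) (x ε : ℝ) (h0 : 0 < ε)
    (h1 : -1 < x - ε) (h2 : x + ε < 1)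
    (hk : ∀ y, -1 ≤ y → y ≤ 1 → k y = 2 * (y * f y) - g y) :
    pvI k x ε = 2 * ((∫ y in (-1 : ℝ)..(x - ε), f y) + ∫ y in (x + ε)..1, f y)
      + 2 * x * pvI f x ε - pvI g x ε := by
  rw [pvI_eq _ _ _ h1.le h2.le, pvI_eq _ _ _ h1.le h2.le, pvI_eq _ _ _ h1.le h2.le]
  have e1 : (∫ y in (-1 : ℝ)..(x - ε), k y / (y - x)) = ∫ y in (-1 : ℝ)..(x - ε),
      (2 * f y + 2 * x * (f y / (y - x)) - g y / (y - x)) := by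
    apply intervalIntegral.integral_congr
    intro y hy
    rw [uIcc_of_le h1.le] at hy
    have : y - x ≠ 0 := by
      have h : y - x < 0 := by linarith [hy.2]
      exact h.ne
    simp only
    rw [hk y hy.1 (by linarith [hy.2])]
    field_simp
    ring
  have e2 : (∫ y in (x + ε)..1, k y / (y - x)) = ∫ y in (x + ε)..1,
      (2 * f y + 2 * x * (f y / (y - x)) - g y / (y - x)) := by
    apply intervalIntegral.integral_congr
    intro y hy
    rw [uIcc_of_le h2.le] at hy
    have : y - x ≠ 0 := by
      have h : 0 < y - x := by linarith [hy.1]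
      exact h.ne'
    simp only
    rw [hk y (by linarith [hy.1]) hy.2]
    field_simp
    ring
  have a1 := cont_left f hf x ε h0 h1.le
  have a2 := cont_left g hg x ε h0 h1.le
  have a3 := cont_right f hf x ε h0 h2.le
  have a4 := cont_right g hg x ε h0 h2.le
  have b1 := hf.intervalIntegrable (μ := volume) (-1) (x - ε)
  have b2 := hf.intervalIntegrable (μ := volume) (x + ε) 1
  rw [e1, e2, intervalIntegral.integral_sub ((b1.const_mul _).add (a1.const_mul _)) a2,
    intervalIntegral.integral_sub ((b2.const_mul _).add (a3.const_mul _)) a4,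
    intervalIntegral.integral_add (b1.const_mul _) (a1.const_mul _),
    intervalIntegral.integral_add (b2.const_mul _) (a3.const_mul _)]
  simp only [intervalIntegral.integral_const_mul]
  ring

lemma pv_J (f : ℝ → ℝ) (hf : Continuous f) (x : ℝ) :
    Tendsto (fun ε => (∫ y in (-1 : ℝ)..(x - ε), f y) + ∫ y in (x + ε)..1, f y) (𝓝[>] 0)
      (𝓝 (∫ y in (-1 : ℝ)..1, f y)) := by
  have hc : Continuous (fun b => ∫ y in (-1 : ℝ)..b, f y) :=
    intervalIntegral.continuous_primitive (fun a b => hf.intervalIntegrable a b) _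
  have hfun : (fun ε => (∫ y in (-1 : ℝ)..(x - ε), f y) + ∫ y in (x + ε)..1, f y) =
      fun ε => (∫ y in (-1 : ℝ)..(x - ε), f y) +
        ((∫ y in (-1 : ℝ)..1, f y) - ∫ y in (-1 : ℝ)..(x + ε), f y) := by
    funext ε
    rw [intervalIntegral.integral_interval_sub_left (hf.intervalIntegrable _ _)
      (hf.intervalIntegrable _ _)]
  rw [hfun]
  have h2 : Continuous (fun ε => (∫ y in (-1 : ℝ)..(x - ε), f y) +
        ((∫ y in (-1 : ℝ)..1, f y) - ∫ y in (-1 : ℝ)..(x + ε), f y)) :=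
    (hc.comp (by fun_prop : Continuous fun ε : ℝ => x - ε)).add
      (continuous_const.sub (hc.comp (by fun_prop : Continuous fun ε : ℝ => x + ε)))
  have h3 := h2.tendsto 0
  simp only [sub_zero, add_zero, add_sub_cancel] at h3
  exact h3.mono_left nhdsWithin_le_nhds

/-- The antiderivative of `√(1-y²)/(y-x)`. -/
def Phi (x y : ℝ) : ℝ :=
  √(1 - x ^ 2) * (Real.log (y - x) - Real.log (1 - x * y + √(1 - x ^ 2) * √(1 - y ^ 2)))
    + √(1 - y ^ 2) - x * Real.arcsin y

lemma D_pos (x y : ℝ) (hx : x ∈ Ioo (-1 : ℝ) 1) (hy : y ∈ Icc (-1 : ℝ) 1) :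
    0 < 1 - x * y + √(1 - x ^ 2) * √(1 - y ^ 2) := by
  have h1 : |x| < 1 := abs_lt.2 hx
  have h2 : |y| ≤ 1 := abs_le.2 hy
  have h3 : x * y ≤ |x| * |y| := by rw [← abs_mul]; exact le_abs_self _
  have : 0 < 1 - x * y := by nlinarith [abs_nonneg x, abs_nonneg y]
  positivity

lemma Phi_deriv (x y : ℝ) (hx : x ∈ Ioo (-1 : ℝ) 1) (hy : y ∈ Ioo (-1 : ℝ) 1) (hxy : y ≠ x) :
    HasDerivAt (Phi x) (√(1 - y ^ 2) / (y - x)) y := by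
  have hD := D_pos x y hx ⟨hy.1.le, hy.2.le⟩
  have hy2 : 0 < 1 - y ^ 2 := by nlinarith [hy.1, hy.2]
  have hx2 : 0 < 1 - x ^ 2 := by nlinarith [hx.1, hx.2]
  have hs : HasDerivAt (fun y : ℝ => √(1 - y ^ 2)) (-y / √(1 - y ^ 2)) y := by
    have h1 : HasDerivAt (fun y : ℝ => 1 - y ^ 2) (-(2 * y)) y := by
      simpa using ((hasDerivAt_pow 2 y).const_sub 1)
    convert h1.sqrt hy2.ne' using 1
    field_simp
  have hl1 : HasDerivAt (fun y : ℝ => Real.log (y - x)) (1 / (y - x)) y :=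
    ((hasDerivAt_id y).sub_const x).log (sub_ne_zero.2 hxy)
  have hlD : HasDerivAt (fun y : ℝ => 1 - x * y + √(1 - x ^ 2) * √(1 - y ^ 2))
      (-(x * 1) + √(1 - x ^ 2) * (-y / √(1 - y ^ 2))) y :=
    (((hasDerivAt_id y).const_mul x).const_sub 1).add (hs.const_mul _)
  have hl2 := hlD.log hD.ne'
  have ha := (Real.hasDerivAt_arcsin hy.1.ne' hy.2.ne).const_mul x
  have := (((hl1.sub hl2).const_mul (√(1 - x ^ 2))).add hs).sub ha
  refine HasDerivAt.congr_deriv (f := Phi x) this ?_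
  have e1 : √(1 - y ^ 2) ^ 2 = 1 - y ^ 2 := Real.sq_sqrt hy2.le
  have e2 : √(1 - x ^ 2) ^ 2 = 1 - x ^ 2 := Real.sq_sqrt hx2.le
  have p1 : 0 < √(1 - y ^ 2) := Real.sqrt_pos.2 hy2
  have hyx : y - x ≠ 0 := sub_ne_zero.2 hxy
  generalize √(1 - y ^ 2) = s at *
  generalize √(1 - x ^ 2) = c at *
  have hD' := hD.ne'
  have key : (-(x * 1) + c * (-y / s)) / (1 - x * y + c * s) = 1 / (y - x) - c / (s * (y - x)) := by
    rw [div_eq_iff hD']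
    field_simp
    grind
  rw [key]
  field_simp
  grind

lemma Phi_contAt (x : ℝ) (hx : x ∈ Ioo (-1 : ℝ) 1) (s : Set ℝ) (hs : s ⊆ Icc (-1) 1)
    (h : ∀ y ∈ s, y ≠ x) : ContinuousOn (Phi x) s := by
  unfold Phi
  have h1 : ContinuousOn (fun y : ℝ => Real.log (y - x)) s :=
    ContinuousOn.log (by fun_prop) (fun y hy => sub_ne_zero.2 (h y hy))
  have h2 : ContinuousOn (fun y : ℝ => Real.log (1 - x * y + √(1 - x ^ 2) * √(1 - y ^ 2))) s :=
    ContinuousOn.log (by fun_prop) (fun y hy => (D_pos x y hx (hs hy)).ne')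
  have h3 : Continuous (fun y : ℝ => √(1 - y ^ 2)) := by fun_prop
  exact ((continuousOn_const.mul (h1.sub h2)).add h3.continuousOn).sub
    (continuousOn_const.mul Real.continuous_arcsin.continuousOn)

lemma Phi_one (x : ℝ) : Phi x 1 = - (x * (Real.pi / 2)) := by
  simp [Phi]

lemma Phi_neg_one (x : ℝ) : Phi x (-1) = x * (Real.pi / 2) := by
  have : Real.log (-1 - x) = Real.log (1 + x) := by
    rw [← Real.log_neg_eq_log]; ring_nf
  simp [Phi, this]

lemma pv_fs_one (x : ℝ) (hx : x ∈ Ioo (-1 : ℝ) 1) :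
    Tendsto (fun ε => pvI (fs 1) x ε) (𝓝[>] 0) (𝓝 (- Real.pi * x)) := by
  let Psi : ℝ → ℝ := fun y => √(1 - x ^ 2) *
      (- Real.log (1 - x * y + √(1 - x ^ 2) * √(1 - y ^ 2))) + √(1 - y ^ 2) - x * Real.arcsin y
  have hPsi : ContinuousAt Psi x := by
    have hD := D_pos x x hx ⟨hx.1.le, hx.2.le⟩
    have h2 : ContinuousAt (fun y : ℝ => Real.log (1 - x * y + √(1 - x ^ 2) * √(1 - y ^ 2))) x :=
      ContinuousAt.log (by fun_prop) hD.ne'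
    have h3 : Continuous (fun y : ℝ => √(1 - y ^ 2)) := by fun_prop
    exact ((continuousAt_const.mul h2.neg).add h3.continuousAt).sub
      (continuousAt_const.mul Real.continuous_arcsin.continuousAt)
  have hev : (fun ε => - Real.pi * x + (Psi (x - ε) - Psi (x + ε))) =ᶠ[𝓝[>] 0]
      (fun ε => pvI (fs 1) x ε) := by
    filter_upwards [ev_range x hx] with ε ⟨h0, h1, h2⟩
    rw [pvI_eq _ _ _ h1.le h2.le]
    have i1 : ∫ y in (-1 : ℝ)..(x - ε), fs 1 y / (y - x) = Phi x (x - ε) - Phi x (-1) := by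
      apply intervalIntegral.integral_eq_sub_of_hasDerivAt_of_le h1.le
      · exact Phi_contAt x hx _ (fun y hy => ⟨hy.1, by linarith [hy.2, hx.2]⟩)
          (fun y hy => by have := hy.2; intro h; linarith)
      · intro y hy
        rw [fs_one]
        exact Phi_deriv x y hx ⟨hy.1, by linarith [hy.2, hx.2]⟩
          (by have := hy.2; intro h; linarith)
      · exact cont_left _ (fs_cont 1) x ε h0 h1.le
    have i2 : ∫ y in (x + ε)..1, fs 1 y / (y - x) = Phi x 1 - Phi x (x + ε) := by
      apply intervalIntegral.integral_eq_sub_of_hasDerivAt_of_le h2.le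
      · exact Phi_contAt x hx _ (fun y hy => ⟨by linarith [hy.1, hx.1], hy.2⟩)
          (fun y hy => by have := hy.1; intro h; linarith)
      · intro y hy
        rw [fs_one]
        exact Phi_deriv x y hx ⟨by linarith [hy.1, hx.1], hy.2⟩
          (by have := hy.1; intro h; linarith)
      · exact cont_right _ (fs_cont 1) x ε h0 h2.le
    rw [i1, i2, Phi_one, Phi_neg_one]
    have l1 : Real.log (x - ε - x) = Real.log ε := by
      rw [show x - ε - x = -ε by ring, Real.log_neg_eq_log]
    have l2 : Real.log (x + ε - x) = Real.log ε := by
      rw [show x + ε - x = ε by ring]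
    simp only [Phi, l1, l2, Psi]
    ring
  refine Tendsto.congr' hev ?_
  have t1 : Tendsto (fun ε : ℝ => Psi (x - ε)) (𝓝[>] 0) (𝓝 (Psi x)) := by
    refine hPsi.tendsto.comp ?_
    have : Tendsto (fun ε : ℝ => x - ε) (𝓝 0) (𝓝 (x - 0)) :=
      (by fun_prop : Continuous fun ε : ℝ => x - ε).tendsto 0
    rw [sub_zero] at this
    exact this.mono_left nhdsWithin_le_nhds
  have t2 : Tendsto (fun ε : ℝ => Psi (x + ε)) (𝓝[>] 0) (𝓝 (Psi x)) := by
    refine hPsi.tendsto.comp ?_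
    have : Tendsto (fun ε : ℝ => x + ε) (𝓝 0) (𝓝 (x + 0)) :=
      (by fun_prop : Continuous fun ε : ℝ => x + ε).tendsto 0
    rw [add_zero] at this
    exact this.mono_left nhdsWithin_le_nhds
  have := (t1.sub t2).const_add (- Real.pi * x)
  simpa using this

lemma pv_fs (x : ℝ) (hx : x ∈ Ioo (-1 : ℝ) 1) (n : ℕ) :
    Tendsto (fun ε => pvI (fs (n + 1)) x ε) (𝓝[>] 0) (𝓝 (- Real.pi * fc (n + 1) x)) := by
  have step : ∀ (k : ℕ) (L M : ℝ), Tendsto (fun ε => pvI (fs (k + 1)) x ε) (𝓝[>] 0) (𝓝 L) →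
      Tendsto (fun ε => pvI (fs k) x ε) (𝓝[>] 0) (𝓝 M) →
      Tendsto (fun ε => pvI (fs (k + 2)) x ε) (𝓝[>] 0)
        (𝓝 (2 * (∫ y in (-1 : ℝ)..1, fs (k + 1) y) + 2 * x * L - M)) := by
    intro k L M hL hM
    refine Tendsto.congr' ?_ ((((pv_J _ (fs_cont (k + 1)) x).const_mul 2).add
      (hL.const_mul (2 * x))).sub hM)
    filter_upwards [ev_range x hx] with ε ⟨h0, h1, h2⟩
    exact (pv_step _ _ _ (fs_cont (k + 1)) (fs_cont k) x ε h0 h1 h2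
      (fun y hy1 hy2 => fs_rec k y hy1 hy2)).symm
  have c1 : fc 1 x = x := by simp [fc, Real.cos_arccos hx.1.le hx.2.le]
  have c0 : fc 0 x = 1 := by simp [fc]
  have f1 : Tendsto (fun ε => pvI (fs 1) x ε) (𝓝[>] 0) (𝓝 (- Real.pi * fc 1 x)) := by
    rw [c1]; exact pv_fs_one x hx
  have f0 : Tendsto (fun ε => pvI (fs 0) x ε) (𝓝[>] 0) (𝓝 0) := by
    have : ∀ ε, pvI (fs 0) x ε = 0 := by intro ε; simp [pvI, fs]
    simp [this]
  have f2 : Tendsto (fun ε => pvI (fs 2) x ε) (𝓝[>] 0) (𝓝 (- Real.pi * fc 2 x)) := by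
    have := step 0 _ _ f1 f0
    rw [int_fs _ (by norm_num), if_pos (by norm_num)] at this
    convert this using 2
    rw [fc_rec 0 x hx.1.le hx.2.le]
    simp only [zero_add, c1, c0]
    ring
  suffices h : Tendsto (fun ε => pvI (fs (n + 1)) x ε) (𝓝[>] 0) (𝓝 (- Real.pi * fc (n + 1) x)) ∧
      Tendsto (fun ε => pvI (fs (n + 2)) x ε) (𝓝[>] 0) (𝓝 (- Real.pi * fc (n + 2) x)) from h.1
  induction n with
  | zero => exact ⟨f1, f2⟩
  | succ n ih =>
    refine ⟨ih.2, ?_⟩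
    have := step (n + 1) _ _ ih.2 ih.1
    rw [int_fs _ (by omega), if_neg (by omega)] at this
    convert this using 2
    rw [show n + 1 + 2 = (n + 1) + 2 from rfl, fc_rec (n + 1) x hx.1.le hx.2.le]
    ring

lemma FHT_fs (c : ℝ) (n : ℕ) (x : ℝ) (hx : x ∈ Ioo (-1 : ℝ) 1) :
    FHT (c • fs (n + 1)) x = - c * fc (n + 1) x := by
  unfold FHT
  apply Tendsto.limUnder_eq
  have h := (pv_fs x hx n).const_mul (c * (1 / Real.pi))
  have e : c * (1 / Real.pi) * (- Real.pi * fc (n + 1) x) = - c * fc (n + 1) x := by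
    have := Real.pi_pos.ne'
    field_simp
  rw [e] at h
  refine h.congr ?_
  intro ε
  simp only [pvI, Pi.smul_apply, smul_eq_mul, mul_div_assoc, integral_const_mul]
  ring

open Polynomial.Chebyshev in
lemma vol_le_measureT (A : Set ℝ) (hA : MeasurableSet A) : vol A ≤ measureT A := by
  rw [measureT, vol, Measure.restrict_apply hA, Measure.restrict_apply hA,
    withDensity_apply _ (hA.inter measurableSet_Ioc)]
  calc volume (A ∩ Ioo (-1 : ℝ) 1) = ∫⁻ x in A ∩ Ioo (-1 : ℝ) 1, 1 := by simp
    _ ≤ ∫⁻ x in A ∩ Ioo (-1 : ℝ) 1,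
        ENNReal.ofNNReal (NNReal.mk (√(1 - x ^ 2)⁻¹) (by positivity)) := by
      apply setLIntegral_mono' (hA.inter measurableSet_Ioo)
      intro x hx
      have h1 : 0 < 1 - x ^ 2 := by nlinarith [hx.2.1, hx.2.2]
      have h2 : 1 ≤ √(1 - x ^ 2)⁻¹ := by
        rw [Real.one_le_sqrt]
        exact (one_le_inv₀ h1).2 (by nlinarith)
      exact_mod_cast h2
    _ ≤ _ := lintegral_mono_set (inter_subset_inter_right _ Ioo_subset_Ioc_self)

instance measureT_finite : IsFiniteMeasure Polynomial.Chebyshev.measureT := by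
  have h : Integrable (fun _ : ℝ => (1 : ℝ)) Polynomial.Chebyshev.measureT :=
    Polynomial.Chebyshev.integrable_measureT continuousOn_const
  rcases (integrable_const_iff.1 h) with h | h
  · norm_num at h
  · exact h

open Polynomial.Chebyshev in
lemma measureT_small (e : ℝ≥0∞) (he : e ≠ 0) :
    ∃ κ > 0, ∀ A, MeasurableSet A → vol A < κ → measureT A < e := by
  let w : ℝ → ℝ≥0∞ := fun x => ENNReal.ofNNReal (NNReal.mk (√(1 - x ^ 2)⁻¹) (by positivity))
  have hT : ∀ A, MeasurableSet A → measureT A = ∫⁻ x in A, w x ∂vol := by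
    intro A hA
    rw [measureT, vol, restrict_withDensity (by measurability), withDensity_apply _ hA,
      Measure.restrict_congr_set (Ioo_ae_eq_Ioc (μ := volume) (a := (-1 : ℝ)) (b := 1)).symm]
  have hfin : ∫⁻ x, w x ∂vol ≠ ∞ := by
    rw [← setLIntegral_univ, ← hT _ MeasurableSet.univ]
    exact measure_ne_top _ _
  obtain ⟨κ, hκ, h⟩ := exists_pos_setLIntegral_lt_of_measure_lt hfin he
  exact ⟨κ, hκ, fun A hA hlt => by rw [hT A hA]; exact h A hlt⟩

instance vol_finite : IsFiniteMeasure vol := by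
  unfold vol
  exact ⟨by simp⟩

/-- uniform lower bound on measure -/
lemma fc_diff_measure : ∃ κ : ℝ≥0∞, 0 < κ ∧ ∀ n m : ℕ, n ≠ 0 → m ≠ 0 → n ≠ m →
    κ ≤ vol {x | 1 / 2 < |fc n x - fc m x|} := by
  obtain ⟨κ, hκ, h⟩ := measureT_small (ENNReal.ofReal (1 / 4)) (by simp)
  refine ⟨κ, hκ, ?_⟩
  intro n m hn hm hnm
  by_contra! hlt
  have hc : Continuous fun x => |fc n x - fc m x| := ((fc_cont n).sub (fc_cont m)).abs
  have hmeas : MeasurableSet {x | 1 / 2 < |fc n x - fc m x|} :=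
    (isOpen_lt continuous_const hc).measurableSet
  have h1 := h _ hmeas hlt
  set A := {x | 1 / 2 < |fc n x - fc m x|} with hA
  set ν := Polynomial.Chebyshev.measureT with hν
  have hreal : ν.real A ≤ 1 / 4 := by
    rw [measureReal_def]
    exact ENNReal.toReal_le_of_le_ofReal (by norm_num) h1.le
  have hI : ∀ g : ℝ → ℝ, Continuous g → Integrable g ν := fun g hg =>
    Polynomial.Chebyshev.integrable_measureT hg.continuousOn
  have hint : ∫ x, (fc n x - fc m x) ^ 2 ∂ν = Real.pi := by
    have e : ∀ x, (fc n x - fc m x) ^ 2 =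
        fc n x * fc n x + fc m x * fc m x - 2 * (fc n x * fc m x) := by intro x; ring
    simp_rw [e]
    have cn := fc_cont n
    have cm := fc_cont m
    rw [integral_sub (hI _ (by fun_prop)) (hI _ (by fun_prop)),
      integral_add (hI _ (by fun_prop)) (hI _ (by fun_prop)), integral_const_mul,
      int_fc_fc n n hn, int_fc_fc m m hm, int_fc_fc n m hn, if_pos rfl, if_pos rfl, if_neg hnm]
    ring
  have huniv : ν.real univ = Real.pi := by
    have := int_cos 0
    simpa using this
  have hle : ∫ x, (fc n x - fc m x) ^ 2 ∂ν ≤ ∫ x, (1 / 4 + A.indicator (fun _ => 4) x) ∂ν := by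
    apply integral_mono
    · have cn := fc_cont n
      have cm := fc_cont m
      exact hI _ (by fun_prop)
    · exact (integrable_const _).add ((integrable_const _).indicator hmeas)
    · intro x
      have b1 := abs_le.1 (fc_le n x)
      have b2 := abs_le.1 (fc_le m x)
      by_cases hx : x ∈ A
      · simp only [indicator_of_mem hx]
        nlinarith
      · simp only [indicator_of_notMem hx]
        have : |fc n x - fc m x| ≤ 1 / 2 := not_lt.1 hx
        have := abs_le.1 this
        nlinarith
  rw [hint, integral_add (integrable_const _) ((integrable_const _).indicator hmeas),
    integral_indicator hmeas, integral_const, setIntegral_const, huniv] at hle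
  simp only [smul_eq_mul] at hle
  have := Real.pi_gt_three
  linarith

/-- indicator function -/
def ind (A : Set ℝ) : ℝ → ℝ := A.indicator (fun _ => 1)

lemma ind_mem (X : BFS) (A : Set ℝ) (hA : MeasurableSet A) : X.Mem (ind A) := by
  classical
  have h := X.simple_mem ((SimpleFunc.const ℝ (1 : ℝ)).restrict A)
  have e : ((SimpleFunc.const ℝ (1 : ℝ)).restrict A : ℝ → ℝ) = ind A := by
    rw [SimpleFunc.coe_restrict _ hA]; rfl
  rwa [e] at h

lemma one_mem (X : BFS) : X.Mem (fun _ => (1 : ℝ)) := by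
  have := ind_mem X univ MeasurableSet.univ
  simpa [ind] using this

lemma bdd_mem (X : BFS) (f : ℝ → ℝ) (hf : AEMeasurable f vol) (C : ℝ) (h : ∀ x, |f x| ≤ C) :
    X.Mem f := by
  refine X.ideal_mem _ f (X.smul_mem C _ (one_mem X)) hf (Eventually.of_forall fun x => ?_)
  simp only [Pi.smul_apply, smul_eq_mul, mul_one]
  exact (h x).trans (le_abs_self _)

lemma zero_mem' (X : BFS) : X.Mem (0 : ℝ → ℝ) := by
  have := X.smul_mem 0 _ (one_mem X)
  simpa using this

lemma sub_mem' (X : BFS) (f g : ℝ → ℝ) (hf : X.Mem f) (hg : X.Mem g) : X.Mem (f - g) := by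
  have := X.add_mem _ _ hf (X.smul_mem (-1) _ hg)
  convert this using 1
  simp [sub_eq_add_neg]

lemma distrib_ind (A : Set ℝ) (lam : ℝ) (hl : 0 < lam) :
    distrib (ind A) lam = if lam < 1 then vol A else 0 := by
  unfold distrib
  split_ifs with h
  · congr 1
    ext x
    by_cases hx : x ∈ A
    · simp [ind, hx, h]
    · simp [ind, hx, hl.le]
  · have : {x | lam < |ind A x|} = ∅ := by
      ext x
      by_cases hx : x ∈ A
      · simpa [ind, hx] using h
      · simp [ind, hx, hl.le]
    rw [this]; simp

lemma nrm_ind_eq (X : BFS) (hri : RearrInvariant X) (A B : Set ℝ) (hA : MeasurableSet A)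
    (hB : MeasurableSet B) (h : vol A = vol B) : X.Nrm (ind A) = X.Nrm (ind B) := by
  refine hri.2.2 _ _ (ind_mem X B hB) (ind_mem X A hA) ?_
  intro lam hl
  rw [distrib_ind A lam hl, distrib_ind B lam hl, h]

lemma vol_Ioo (a : ℝ) (ha0 : 0 ≤ a) (ha : a ≤ 1) :
    vol (Ioo (-a) a) = ENNReal.ofReal (2 * a) := by
  rw [vol, Measure.restrict_apply measurableSet_Ioo, inter_eq_left.2
    (Ioo_subset_Ioo (by linarith) ha), Real.volume_Ioo]
  congr 1; ring

lemma vol_univ : vol univ = ENNReal.ofReal 2 := by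
  rw [vol, Measure.restrict_apply MeasurableSet.univ, univ_inter, Real.volume_Ioo]
  norm_num

lemma nrm_ind_mono_set (X : BFS) (A B : Set ℝ) (hA : MeasurableSet A)
    (hB : MeasurableSet B) (h : A ⊆ B) : X.Nrm (ind A) ≤ X.Nrm (ind B) := by
  refine X.nrm_mono _ _ (ind_mem X A hA) (ind_mem X B hB) (Eventually.of_forall fun x => ?_)
  by_cases hx : x ∈ A
  · simp [ind, hx, h hx]
  · simp [ind, hx]

lemma nrm_ind_mono (X : BFS) (hri : RearrInvariant X) (A B : Set ℝ) (hA : MeasurableSet A)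
    (hB : MeasurableSet B) (h : vol A ≤ vol B) : X.Nrm (ind A) ≤ X.Nrm (ind B) := by
  have key : ∀ A : Set ℝ, MeasurableSet A → ∃ a, 0 ≤ a ∧ a ≤ 1 ∧ (vol A).toReal = 2 * a ∧
      X.Nrm (ind A) = X.Nrm (ind (Ioo (-a) a)) := by
    intro A hA
    have hle : (vol A).toReal ≤ 2 := by
      refine ENNReal.toReal_le_of_le_ofReal (by norm_num) ?_
      rw [← vol_univ]; exact measure_mono (subset_univ _)
    have h0 : 0 ≤ (vol A).toReal := ENNReal.toReal_nonneg
    refine ⟨(vol A).toReal / 2, by linarith, by linarith, by ring, ?_⟩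
    refine nrm_ind_eq X hri _ _ hA measurableSet_Ioo ?_
    rw [vol_Ioo _ (by linarith) (by linarith), mul_div_cancel₀ _ two_ne_zero,
      ENNReal.ofReal_toReal (measure_ne_top _ _)]
  obtain ⟨a, ha0, ha1, hav, han⟩ := key A hA
  obtain ⟨b, hb0, hb1, hbv, hbn⟩ := key B hB
  have : (vol A).toReal ≤ (vol B).toReal := ENNReal.toReal_mono (measure_ne_top _ _) h
  rw [han, hbn]
  exact nrm_ind_mono_set X _ _ measurableSet_Ioo measurableSet_Ioo
    (Ioo_subset_Ioo (by linarith) (by linarith))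

lemma exists_dil (X : BFS) (hB : NontrivialBoyd X) : ∃ t ∈ Ioo (0 : ℝ) 1, ∃ C, 0 ≤ C ∧ C < 1 ∧
    ∀ f, X.Mem f → X.Mem (dilate (1 / t) f) ∧ X.Nrm (dilate (1 / t) f) ≤ C * X.Nrm f := by
  have h0 := hB.1
  have : ∃ r ∈ {r : ℝ | ∃ t ∈ Set.Ioo (0 : ℝ) 1,
      r = Real.log (dilNorm X (1 / t)) / Real.log t}, 0 < r := by
    by_contra! hcon
    exact absurd (Real.sSup_nonpos hcon) (not_le.2 h0)
  obtain ⟨r, ⟨t, ht, rfl⟩, hr⟩ := this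
  have hlt : Real.log t < 0 := Real.log_neg ht.1 ht.2
  have hld : Real.log (dilNorm X (1 / t)) < 0 := by
    rcases div_pos_iff.1 hr with h | h
    · exact absurd h.2 (not_lt.2 hlt.le)
    · exact h.1
  have hnn : 0 ≤ dilNorm X (1 / t) := Real.sInf_nonneg fun C hC => hC.1
  have hlt1 : dilNorm X (1 / t) < 1 := by
    by_contra! hcon
    exact absurd (Real.log_nonneg hcon) (not_le.2 hld)
  have hne : dilNorm X (1 / t) ≠ 0 := by
    intro h; rw [h] at hld; simp at hld
  have hnon : {C : ℝ | 0 ≤ C ∧ ∀ f, X.Mem f → X.Mem (dilate (1 / t) f) ∧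
      X.Nrm (dilate (1 / t) f) ≤ C * X.Nrm f}.Nonempty := by
    by_contra hcon
    rw [not_nonempty_iff_eq_empty] at hcon
    apply hne
    unfold dilNorm
    rw [hcon, Real.sInf_empty]
  obtain ⟨C, hC, hC1⟩ := exists_lt_of_csInf_lt hnon hlt1
  exact ⟨t, ht, C, hC.1, hC1, hC.2⟩

lemma dil_ind (t a : ℝ) (ht : t ∈ Ioo (0 : ℝ) 1) (ha : a ≤ 1) :
    dilate (1 / t) (ind (Ioo (-a) a)) = ind (Ioo (-(t * a)) (t * a)) := by
  funext x
  have e : ∀ b, (1 / t * x ∈ Ioo (-b) b ↔ x ∈ Ioo (-(t * b)) (t * b)) := by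
    intro b
    simp only [mem_Ioo, one_div, inv_mul_eq_div, lt_div_iff₀ ht.1, div_lt_iff₀ ht.1]
    constructor <;> rintro ⟨h1, h2⟩ <;> constructor <;> nlinarith
  have hsub : 1 / t * x ∈ Ioo (-a) a → 1 / t * x ∈ Ioo (-1 : ℝ) 1 :=
    fun h => ⟨by linarith [h.1], by linarith [h.2]⟩
  unfold dilate ind
  by_cases h : 1 / t * x ∈ Ioo (-a) a
  · rw [if_pos (hsub h), indicator_of_mem h, indicator_of_mem ((e a).1 h)]
  · rw [indicator_of_notMem h, indicator_of_notMem (fun h' => h ((e a).2 h'))]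
    simp

lemma nrm_ind_small (X : BFS) (hri : RearrInvariant X) (hB : NontrivialBoyd X) (e : ℝ)
    (he : 0 < e) : ∃ d : ℝ, 0 < d ∧ ∀ A, MeasurableSet A → vol A ≤ ENNReal.ofReal d →
      X.Nrm (ind A) < e := by
  obtain ⟨t, ht, C, hC0, hC1, hC⟩ := exists_dil X hB
  have hk : ∀ k : ℕ, X.Nrm (ind (Ioo (-(t ^ k)) (t ^ k))) ≤ C ^ k * X.Nrm (ind (Ioo (-1) 1)) := by
    intro k
    induction k with
    | zero => simp
    | succ k ih =>
      have h1 := (hC _ (ind_mem X (Ioo (-(t ^ k)) (t ^ k)) measurableSet_Ioo)).2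
      rw [dil_ind t _ ht (pow_le_one₀ ht.1.le ht.2.le), ← pow_succ'] at h1
      calc _ ≤ _ := h1
        _ ≤ C * (C ^ k * X.Nrm (ind (Ioo (-1) 1))) := by gcongr
        _ = _ := by ring
  have hlim : Tendsto (fun k : ℕ => C ^ k * X.Nrm (ind (Ioo (-1) 1))) atTop (𝓝 0) := by
    simpa using (tendsto_pow_atTop_nhds_zero_of_lt_one hC0 hC1).mul_const
      (X.Nrm (ind (Ioo (-1) 1)))
  obtain ⟨k, hk2⟩ := (hlim.eventually (gt_mem_nhds he)).exists
  have htk : 0 < t ^ k := pow_pos ht.1 k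
  refine ⟨2 * t ^ k, by linarith, fun A hA hv => ?_⟩
  rw [← vol_Ioo _ htk.le (pow_le_one₀ ht.1.le ht.2.le)] at hv
  exact (nrm_ind_mono X hri _ _ hA measurableSet_Ioo hv).trans_lt ((hk k).trans_lt hk2)

lemma nrm_ind_pos (X : BFS) (A : Set ℝ) (hA : MeasurableSet A) (h : 0 < vol A) :
    0 < X.Nrm (ind A) := by
  refine lt_of_le_of_ne (X.nrm_nonneg _ (ind_mem X A hA)) fun h0 => ?_
  have := (X.nrm_eq_zero_iff _ (ind_mem X A hA)).1 h0.symm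
  have h2 : vol A = 0 := by
    refine measure_mono_null ?_ this
    intro x hx
    simp [ind, hx]
  exact h.ne' h2

lemma one_pos' (X : BFS) : 0 < X.Nrm (fun _ => (1 : ℝ)) := by
  have := nrm_ind_pos X univ MeasurableSet.univ (by rw [vol_univ]; simp)
  simpa [ind] using this

lemma nrm_sub_comm (X : BFS) (f g : ℝ → ℝ) (hf : X.Mem f) (hg : X.Mem g) :
    X.Nrm (f - g) = X.Nrm (g - f) := by
  have h := X.nrm_smul (-1) _ (sub_mem' X g f hg hf)
  simpa using h

/-- No subsequence of a nonzero multiple of `fc (n+1)` converges in norm. -/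
lemma not_norm_conv (X : BFS) (hri : RearrInvariant X) (c : ℝ) (hc : c ≠ 0) (F : ℕ → ℝ → ℝ)
    (hF : ∀ n, X.Mem (F n)) (hFc : ∀ n, ∀ᵐ x ∂vol, F n x = c * fc (n + 1) x)
    (φ : ℕ → ℕ) (hφ : StrictMono φ) (g : ℝ → ℝ) (hg : X.Mem g)
    (hlim : Tendsto (fun n => X.Nrm (F (φ n) - g)) atTop (𝓝 0)) : False := by
  obtain ⟨κ, hκ, h⟩ := fc_diff_measure
  -- a measurable set with the minimal measure
  let B : ℕ → Set ℝ := fun n => {x | 1 / 2 < |fc (φ n + 1) x - fc (φ (n + 1) + 1) x|}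
  have hBm : ∀ n, MeasurableSet (B n) := fun n =>
    (isOpen_lt continuous_const ((fc_cont _).sub (fc_cont _)).abs).measurableSet
  have hBv : ∀ n, κ ≤ vol (B n) := fun n => h _ _ (by omega) (by omega) (by
    have := hφ (Nat.lt_succ_self n)
    simp only [Nat.succ_eq_add_one] at this
    omega)
  -- comparison interval
  have hκ2 : κ ≤ ENNReal.ofReal 2 := (hBv 0).trans (by
    rw [← vol_univ]; exact measure_mono (subset_univ _))
  have hκt : κ ≠ ∞ := ne_top_of_le_ne_top (by simp) hκ2
  have hk0 : 0 < κ.toReal := ENNReal.toReal_pos hκ.ne' hκt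
  have hk2 : κ.toReal ≤ 2 := ENNReal.toReal_le_of_le_ofReal (by norm_num) hκ2
  have hI : vol (Ioo (-(κ.toReal / 2)) (κ.toReal / 2)) = κ := by
    rw [vol_Ioo _ (by linarith) (by linarith), mul_div_cancel₀ _ two_ne_zero,
      ENNReal.ofReal_toReal hκt]
  set I := Ioo (-(κ.toReal / 2)) (κ.toReal / 2) with hIdef
  have hp := nrm_ind_pos X I measurableSet_Ioo (by rw [hI]; exact hκ)
  have hlow : ∀ n, |c| / 2 * X.Nrm (ind I) ≤ X.Nrm (F (φ n) - F (φ (n + 1))) := by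
    intro n
    have h1 := nrm_ind_mono X hri I (B n) measurableSet_Ioo (hBm n) (by rw [hI]; exact hBv n)
    have h2 : X.Nrm ((|c| / 2) • ind (B n)) ≤ X.Nrm (F (φ n) - F (φ (n + 1))) := by
      refine X.nrm_mono _ _ (X.smul_mem _ _ (ind_mem X _ (hBm n)))
        (sub_mem' X _ _ (hF _) (hF _)) ?_
      filter_upwards [hFc (φ n), hFc (φ (n + 1))] with x hx1 hx2
      simp only [Pi.sub_apply, Pi.smul_apply, smul_eq_mul, hx1, hx2]
      rw [← mul_sub, abs_mul, abs_mul, abs_of_nonneg (by positivity : 0 ≤ |c| / 2)]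
      by_cases hx : x ∈ B n
      · have : 1 / 2 < |fc (φ n + 1) x - fc (φ (n + 1) + 1) x| := hx
        simp only [ind, indicator_of_mem hx, abs_one]
        nlinarith [abs_nonneg c]
      · simp only [ind, indicator_of_notMem hx, abs_zero, mul_zero]
        positivity
    rw [X.nrm_smul _ _ (ind_mem X _ (hBm n)), abs_of_nonneg (by positivity : 0 ≤ |c| / 2)] at h2
    refine le_trans ?_ h2
    gcongr
  have hup : ∀ n, X.Nrm (F (φ n) - F (φ (n + 1))) ≤
      X.Nrm (F (φ n) - g) + X.Nrm (F (φ (n + 1)) - g) := by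
    intro n
    rw [nrm_sub_comm X (F (φ (n + 1))) g (hF _) hg]
    have := X.nrm_add_le _ _ (sub_mem' X _ _ (hF (φ n)) hg) (sub_mem' X _ _ hg (hF (φ (n + 1))))
    rwa [sub_add_sub_cancel] at this
  have hl2 : Tendsto (fun n => X.Nrm (F (φ n) - g) + X.Nrm (F (φ (n + 1)) - g)) atTop (𝓝 0) := by
    simpa using hlim.add (hlim.comp (tendsto_add_atTop_nat 1))
  have := ge_of_tendsto' hl2 (fun n => (hlow n).trans (hup n))
  have : 0 < |c| / 2 * X.Nrm (ind I) := by positivity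
  linarith

lemma sum_fs_sq (σ : ℕ → ℝ) (hσ : ∀ n, |σ n| ≤ 1) (s : Finset ℕ) :
    ∫ x, (∑ n ∈ s, σ n * fs (n + 1) x) ^ 2 ∂Polynomial.Chebyshev.measureT ≤ 2 * s.card := by
  have e : ∀ x, (∑ n ∈ s, σ n * fs (n + 1) x) ^ 2 =
      ∑ n ∈ s, ∑ m ∈ s, σ n * σ m * (fs (n + 1) x * fs (m + 1) x) := by
    intro x
    rw [sq, Finset.sum_mul_sum]
    refine Finset.sum_congr rfl fun n _ => Finset.sum_congr rfl fun m _ => by ring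
  have hi : ∀ n m : ℕ, Integrable (fun x => σ n * σ m * (fs (n + 1) x * fs (m + 1) x))
      Polynomial.Chebyshev.measureT := fun n m =>
    Polynomial.Chebyshev.integrable_measureT
      (continuous_const.mul ((fs_cont _).mul (fs_cont _))).continuousOn
  simp_rw [e]
  rw [integral_finset_sum _ (fun n _ => integrable_finset_sum _ fun m _ => hi n m)]
  have : ∀ n ∈ s, ∫ x, ∑ m ∈ s, σ n * σ m * (fs (n + 1) x * fs (m + 1) x)
      ∂Polynomial.Chebyshev.measureT ≤ 2 := by
    intro n hn
    rw [integral_finset_sum _ (fun m _ => hi n m)]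
    simp_rw [integral_const_mul, int_fs_fs (n + 1) _ (Nat.succ_ne_zero n)]
    rw [Finset.sum_eq_single_of_mem n hn
      (fun m _ hm => by rw [if_neg (by omega), mul_zero]), if_pos rfl]
    have h1 := abs_le.1 (hσ n)
    have h2 := Real.pi_lt_four
    have h3 := Real.pi_pos
    have h4 : σ n * σ n ≤ 1 := by nlinarith
    nlinarith [mul_self_nonneg (σ n)]
  calc _ ≤ ∑ n ∈ s, (2 : ℝ) := Finset.sum_le_sum this
    _ = _ := by simp [mul_comm]

lemma functional_sum (X : BFS) (ψ : (ℝ → ℝ) → ℝ) (hψ : Functional X ψ) (f : ℕ → ℝ → ℝ)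
    (hf : ∀ n, X.Mem (f n)) (σ : ℕ → ℝ) (s : Finset ℕ) :
    X.Mem (∑ n ∈ s, σ n • f n) ∧ ψ (∑ n ∈ s, σ n • f n) = ∑ n ∈ s, σ n * ψ (f n) := by
  classical
  induction s using Finset.induction_on with
  | empty =>
    refine ⟨by simpa using zero_mem' X, ?_⟩
    have := hψ.2.1 0 0 (zero_mem' X)
    simpa using this
  | insert a s ha ih =>
    rw [Finset.sum_insert ha, Finset.sum_insert ha]
    have h1 := X.smul_mem (σ a) _ (hf a)
    refine ⟨X.add_mem _ _ h1 ih.1, ?_⟩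
    rw [hψ.1 _ _ h1 ih.1, hψ.2.1 _ _ (hf a), ih.2]

lemma fs_mem (X : BFS) (n : ℕ) : X.Mem (fs n) :=
  bdd_mem X _ (fs_cont n).aemeasurable 1 (fs_le n)

lemma weak_null (X : BFS) (hri : RearrInvariant X) (hB : NontrivialBoyd X)
    (ψ : (ℝ → ℝ) → ℝ) (hψ : Functional X ψ) :
    Tendsto (fun n => ψ (fs (n + 1))) atTop (𝓝 0) := by
  obtain ⟨C0, hC0⟩ := hψ.2.2.2
  obtain ⟨C, hCpos, hC⟩ : ∃ C : ℝ, 0 < C ∧ ∀ f, X.Mem f → |ψ f| ≤ C * X.Nrm f := by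
    refine ⟨max C0 1, by positivity, fun f hf => (hC0 f hf).trans ?_⟩
    have := X.nrm_nonneg f hf
    gcongr
    exact le_max_left _ _
  rw [Metric.tendsto_atTop]
  by_contra! hcon
  obtain ⟨ε, hε, hfreq⟩ := hcon
  have hfr : ∃ᶠ n in atTop, ε ≤ dist (ψ (fs (n + 1))) 0 := by
    rw [frequently_atTop]
    exact fun N => hfreq N
  obtain ⟨φ, hφ, hφε⟩ := extraction_of_frequently_atTop hfr
  have hone := one_pos' X
  set K := X.Nrm (fun _ => (1 : ℝ)) with hK
  -- choose δ
  let δ : ℝ := ε / (4 * C * K)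
  have hδ : 0 < δ := by positivity
  obtain ⟨d, hd, hsmall⟩ := nrm_ind_small X hri hB (ε / (4 * C)) (by positivity)
  obtain ⟨N, hN⟩ := exists_nat_gt (2 / (δ ^ 2 * d))
  have hNpos : (0 : ℝ) < N := lt_of_le_of_lt (by positivity) hN
  let s : Finset ℕ := (Finset.range N).image φ
  have hcard : s.card = N := by
    rw [Finset.card_image_of_injective _ hφ.injective, Finset.card_range]
  let σ : ℕ → ℝ := fun n => SignType.sign (ψ (fs (n + 1)))
  have hσ : ∀ n, |σ n| ≤ 1 := by
    intro n
    simp only [σ]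
    rcases lt_trichotomy (ψ (fs (n + 1))) 0 with h | h | h
    · simp [sign_neg h]
    · simp [h]
    · simp [sign_pos h]
  obtain ⟨hGm, hGψ⟩ := functional_sum X ψ hψ (fun n => fs (n + 1)) (fun n => fs_mem X _) σ s
  set G : ℝ → ℝ := ∑ n ∈ s, σ n • fs (n + 1) with hG
  have hGx : ∀ x, G x = ∑ n ∈ s, σ n * fs (n + 1) x := by
    intro x; simp [hG, Finset.sum_apply]
  have hGcont : Continuous G := by
    have : G = fun x => ∑ n ∈ s, σ n * fs (n + 1) x := funext hGx
    rw [this]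
    exact continuous_finset_sum _ fun n _ => continuous_const.mul (fs_cont _)
  have hlow : N * ε ≤ ψ G := by
    rw [hGψ]
    have : ∀ n ∈ s, ε ≤ σ n * ψ (fs (n + 1)) := by
      intro n hn
      obtain ⟨k, _, rfl⟩ := Finset.mem_image.1 hn
      have := hφε k
      simp only [σ]
      rw [sign_mul_self]
      simpa using this
    calc N * ε = ∑ n ∈ s, ε := by simp [hcard]
      _ ≤ _ := Finset.sum_le_sum this
  have hGabs : ∀ x, |G x| ≤ N := by
    intro x
    rw [hGx]
    calc _ ≤ ∑ n ∈ s, |σ n * fs (n + 1) x| := Finset.abs_sum_le_sum_abs _ _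
      _ ≤ ∑ n ∈ s, (1 : ℝ) := by
        refine Finset.sum_le_sum fun n _ => ?_
        rw [abs_mul]
        exact mul_le_one₀ (hσ n) (abs_nonneg _) (fs_le _ _)
      _ = N := by simp [hcard]
  let A : Set ℝ := {x | (δ * N) ^ 2 ≤ (G x) ^ 2}
  have hAm : MeasurableSet A :=
    (isClosed_le continuous_const (hGcont.pow 2)).measurableSet
  have hAv : vol A ≤ ENNReal.ofReal d := by
    refine (vol_le_measureT A hAm).trans ?_
    have h1 := mul_meas_ge_le_integral_of_nonneg (μ := Polynomial.Chebyshev.measureT)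
      (f := fun x => (G x) ^ 2) (Eventually.of_forall fun x => sq_nonneg _)
      (Polynomial.Chebyshev.integrable_measureT (hGcont.pow 2).continuousOn) ((δ * N) ^ 2)
    have h2 := sum_fs_sq σ hσ s
    simp_rw [← hGx] at h2
    rw [hcard] at h2
    have h3 := h1.trans h2
    rw [← ENNReal.ofReal_toReal (measure_ne_top Polynomial.Chebyshev.measureT A)]
    apply ENNReal.ofReal_le_ofReal
    change (δ * N) ^ 2 * (Polynomial.Chebyshev.measureT A).toReal ≤ 2 * N at h3
    rw [div_lt_iff₀ (by positivity)] at hN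
    have h5 : 0 < (δ * N) ^ 2 := by positivity
    refine le_of_mul_le_mul_left (h3.trans ?_) h5
    nlinarith
  have hA1 := hsmall A hAm hAv
  have hGn : X.Nrm G ≤ N * (δ * K + X.Nrm (ind A)) := by
    have m1 := X.smul_mem (δ * N) _ (one_mem X)
    have m2 := X.smul_mem (N : ℝ) _ (ind_mem X A hAm)
    have h1 : X.Nrm G ≤ X.Nrm ((δ * N) • (fun _ => (1 : ℝ)) + (N : ℝ) • ind A) := by
      refine X.nrm_mono _ _ hGm (X.add_mem _ _ m1 m2) (Eventually.of_forall fun x => ?_)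
      refine le_trans ?_ (le_abs_self _)
      simp only [Pi.add_apply, Pi.smul_apply, smul_eq_mul, mul_one]
      by_cases hx : x ∈ A
      · simp only [ind, indicator_of_mem hx, mul_one]
        have := hGabs x
        have : 0 < δ * N := by positivity
        linarith
      · simp only [ind, indicator_of_notMem hx, mul_zero, add_zero]
        have h6 : (G x) ^ 2 < (δ * N) ^ 2 := not_le.1 hx
        exact (abs_lt_of_sq_lt_sq h6 (by positivity)).le
    refine h1.trans ((X.nrm_add_le _ _ m1 m2).trans (le_of_eq ?_))
    rw [X.nrm_smul _ _ (one_mem X), X.nrm_smul _ _ (ind_mem X A hAm),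
      abs_of_nonneg (by positivity : 0 ≤ δ * N), abs_of_nonneg hNpos.le, ← hK]
    ring
  have h1 : N * ε ≤ C * (N * (δ * K + X.Nrm (ind A))) :=
    hlow.trans ((le_abs_self _).trans ((hC G hGm).trans (by gcongr)))
  have h2 : δ * K = ε / (4 * C) := by
    simp only [δ]; field_simp
  have h3 : C * (δ * K + X.Nrm (ind A)) < ε := by
    have : C * (ε / (4 * C)) = ε / 4 := by field_simp
    rw [h2]
    nlinarith
  nlinarith

lemma relWeak (X : BFS) (hri : RearrInvariant X) (hB : NontrivialBoyd X) :
    RelWeaklyCompact X (range fun n : ℕ => fs (n + 1)) := by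
  intro f hf
  choose k hk using hf
  by_cases h : Tendsto k atTop atTop
  · refine ⟨id, strictMono_id, 0, zero_mem' X, fun ψ hψ => ?_⟩
    have h0 : ψ 0 = 0 := by
      have := hψ.2.1 0 0 (zero_mem' X)
      simpa using this
    rw [h0]
    have := (weak_null X hri hB ψ hψ).comp h
    refine this.congr fun n => ?_
    simp only [Function.comp, id, ← hk]
  · rw [tendsto_atTop] at h
    push Not at h
    obtain ⟨b, hb⟩ := h
    have : ∃ j, ∃ᶠ n in atTop, k n = j := by
      by_contra! hcon
      apply hb
      have h1 : ∀ᶠ n in atTop, ∀ j ∈ Finset.range b, ¬ k n = j := by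
        rw [Filter.eventually_all_finset]
        intro j _
        have := hcon j
        exact not_frequently.1 (by simpa using this)
      filter_upwards [h1] with n hn
      by_contra! hlt
      exact hn (k n) (Finset.mem_range.2 hlt) rfl
    obtain ⟨j, hj⟩ := this
    obtain ⟨φ, hφ, hφj⟩ := extraction_of_frequently_atTop hj
    refine ⟨φ, hφ, fs (j + 1), fs_mem X _, fun ψ _ => ?_⟩
    have : ∀ n, f (φ n) = fs (j + 1) := by intro n; rw [← hk, hφj]
    simp [this]

lemma ae_vol_of (P : ℝ → Prop) (h : ∀ x ∈ Ioo (-1 : ℝ) 1, P x) : ∀ᵐ x ∂vol, P x := by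
  unfold vol
  exact (ae_restrict_iff' measurableSet_Ioo).2 (Eventually.of_forall h)

lemma FHT_ind (a x : ℝ) (hx : x ∈ Ioo (-1 : ℝ) 1) (hxa : x < a) (ha : a < 1) :
    FHT (ind (Ioo a 1)) x = (1 / Real.pi) * (Real.log (1 - x) - Real.log (a - x)) := by
  unfold FHT
  apply Tendsto.limUnder_eq
  refine tendsto_const_nhds.congr' ?_
  have hr : ∀ᶠ ε in 𝓝[>] (0 : ℝ), ε ∈ Ioo (0 : ℝ) (a - x) := Ioo_mem_nhdsGT (by linarith)
  filter_upwards [hr] with ε hε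
  have e1 : ∫ y in Ioo (-1 : ℝ) (x - ε), ind (Ioo a 1) y / (y - x) = 0 := by
    apply setIntegral_eq_zero_of_forall_eq_zero
    intro y hy
    have : y ∉ Ioo a 1 := fun h => by linarith [h.1, hy.2, hε.1]
    simp [ind, indicator_of_notMem this]
  have e2 : ∫ y in Ioo (x + ε) 1, ind (Ioo a 1) y / (y - x) = ∫ y in Ioo a 1, 1 / (y - x) := by
    have : (fun y => ind (Ioo a 1) y / (y - x)) = (Ioo a 1).indicator fun y => 1 / (y - x) := by
      funext y
      by_cases h : y ∈ Ioo a 1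
      · simp only [ind, indicator_of_mem h]
      · simp only [ind, indicator_of_notMem h, zero_div]
    rw [this, setIntegral_indicator measurableSet_Ioo, inter_eq_right.2
      (Ioo_subset_Ioo (by linarith [hε.2]) le_rfl)]
  have e3 : ∫ y in Ioo a 1, 1 / (y - x) = Real.log (1 - x) - Real.log (a - x) := by
    rw [← integral_Ioc_eq_integral_Ioo, ← intervalIntegral.integral_of_le ha.le]
    have hne : ∀ y ∈ uIcc a 1, y - x ≠ 0 := by
      intro y hy
      rw [uIcc_of_le ha.le] at hy
      have h : 0 < y - x := by linarith [hy.1]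
      exact h.ne'
    refine intervalIntegral.integral_eq_sub_of_hasDerivAt (f := fun y => Real.log (y - x)) ?_ ?_
    · intro y hy
      exact ((hasDerivAt_id y).sub_const x).log (hne y hy)
    · exact ContinuousOn.intervalIntegrable (continuousOn_const.div (by fun_prop) hne)
  rw [e1, e2, e3, zero_add]

lemma not_orderBdd (X : BFS) : ¬ OrderBoundedOp X FHT := by
  intro h
  let S : Set (ℝ → ℝ) := range fun a : ℝ => ind (Ioo a 1)
  have hS : ∀ f ∈ S, X.Mem f := by
    rintro _ ⟨a, rfl⟩
    exact ind_mem X _ measurableSet_Ioo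
  obtain ⟨g, _, hg⟩ := h S hS ⟨_, one_mem X, by
    rintro _ ⟨a, rfl⟩
    refine Eventually.of_forall fun x => ?_
    by_cases hx : x ∈ Ioo a 1
    · simp [ind, indicator_of_mem hx]
    · simp [ind, indicator_of_notMem hx]⟩
  have hall : ∀ᵐ x ∂vol, ∀ q : ℚ, |FHT (ind (Ioo (q : ℝ) 1)) x| ≤ g x := by
    rw [ae_all_iff]
    intro q
    exact hg _ ⟨_, ⟨(q : ℝ), rfl⟩, rfl⟩
  have hin : ∀ᵐ x ∂vol, x ∈ Ioo (-1 : ℝ) 1 := ae_vol_of _ fun x hx => hx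
  haveI : NeZero vol := ⟨fun h0 => by
    have := vol_univ
    rw [h0] at this
    simp at this⟩
  obtain ⟨x, hx, hxg⟩ := (hin.and hall).exists
  have hlim : Tendsto (fun t : ℝ => (1 / Real.pi) * (Real.log (1 - x) - Real.log t)) (𝓝[>] 0)
      atTop := by
    apply Tendsto.const_mul_atTop (by have := Real.pi_pos; positivity)
    have := (tendsto_neg_atBot_atTop.comp Real.tendsto_log_nhdsGT_zero)
    have := tendsto_atTop_add_const_left _ (Real.log (1 - x)) this
    refine this.congr fun t => ?_
    simp [sub_eq_add_neg]
  have hev := (hlim.eventually (eventually_gt_atTop (g x)))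
  have hev2 : ∀ᶠ t in 𝓝[>] (0 : ℝ), t ∈ Ioo (0 : ℝ) (1 - x) :=
    Ioo_mem_nhdsGT (by linarith [hx.2])
  rw [eventually_nhdsWithin_iff] at hev hev2
  obtain ⟨r, hr, hball⟩ := Metric.eventually_nhds_iff.1 (hev.and hev2)
  obtain ⟨q, hq1, hq2⟩ := exists_rat_btwn (show x < x + r by linarith)
  have hd : dist ((q : ℝ) - x) 0 < r := by
    rw [Real.dist_eq, sub_zero, abs_of_pos (by linarith)]; linarith
  obtain ⟨b1, b2⟩ := hball hd
  have hpos : (q : ℝ) - x ∈ Ioi (0 : ℝ) := by simp only [mem_Ioi]; linarith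
  have c1 := b1 hpos
  have c2 := (b2 hpos).2
  have := hxg q
  rw [FHT_ind q x hx hq1 (by linarith)] at this
  have := (le_abs_self _).trans this
  linarith

/-- The finite Hilbert transform `T_X : X → X` is neither completely continuous nor order
bounded; in particular it is not compact. -/
theorem FHT_not_completelyContinuous_not_orderBounded (X : BFS) (hri : RearrInvariant X)
    (hB : NontrivialBoyd X) (hT : THilbBounded X) :
    ¬ CompletelyContinuousOp X FHT ∧ ¬ OrderBoundedOp X FHT ∧ ¬ CompactOp X FHT := by
  refine ⟨?_, not_orderBdd X, ?_⟩
  · intro h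
    have h2 := h _ (by rintro _ ⟨n, rfl⟩; exact fs_mem X _) (relWeak X hri hB)
    obtain ⟨φ, hφ, g, hg, hlim⟩ := h2 (fun n => FHT (fs (n + 1))) (fun n => ⟨_, ⟨n, rfl⟩, rfl⟩)
    refine not_norm_conv X hri (-1) (by norm_num) (fun n => FHT (fs (n + 1)))
      (fun n => hT.1 _ (fs_mem X _)) (fun n => ae_vol_of _ fun x hx => ?_) φ hφ g hg hlim
    have := FHT_fs 1 n x hx
    rwa [one_smul] at this
  · intro h
    have hK := one_pos' X
    set K := X.Nrm (fun _ => (1 : ℝ)) with hKdef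
    have hle : ∀ n, X.Nrm (fs n) ≤ K := fun n =>
      X.nrm_mono _ _ (fs_mem X n) (one_mem X) (Eventually.of_forall fun x => by
        simpa using fs_le n x)
    obtain ⟨φ, hφ, g, hg, hlim⟩ := h (fun n => FHT (K⁻¹ • fs (n + 1))) (fun n => ⟨_,
      ⟨X.smul_mem _ _ (fs_mem X _), by
        rw [X.nrm_smul _ _ (fs_mem X _), abs_of_pos (inv_pos.2 hK), inv_mul_le_iff₀ hK, mul_one]
        exact hle _⟩, rfl⟩)
    exact not_norm_conv X hri (-K⁻¹) (neg_ne_zero.2 (inv_ne_zero hK.ne'))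
      (fun n => FHT (K⁻¹ • fs (n + 1)))
      (fun n => hT.1 _ (X.smul_mem _ _ (fs_mem X _)))
      (fun n => ae_vol_of _ fun x hx => FHT_fs _ n x hx) φ hφ g hg hlim
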